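/- arXiv:1009.5797 — 2 statements merged into one kernel-verified Lean document; each statement's English description precedes it below -/
import Mathlib

section
/- Let p ≥ 1 and ν ≥ 1 be integers, R > 0, and ζ ∈ (0,π). Then Σ_{j=0}^∞ (j+ν) (−1)^j I_{p(j+ν)}(R) C_j^ν(cos ζ) equals ((−1)^ν/(2^ν (ν−1)!)) · L^ν[ ζ ↦ (1/p) Σ_{s=1}^p exp( R cos((ζ+(2s+1)π)/p) ) ](ζ), where L^ν is applied to the indicated function of ζ and then evaluated at ζ. -/
/-- Modified Bessel function of the first kind of real order `α ≥ 0`. -/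
noncomputable def besselI (α R : ℝ) : ℝ :=
  ∑' m : ℕ, (R / 2) ^ (2 * (m : ℝ) + α) / (Nat.factorial m * Real.Gamma ((m : ℝ) + α + 1))

/-- Gegenbauer polynomial `C_j^ν(x)` for real `ν > 0`. -/
noncomputable def gegenbauerC (ν : ℝ) (j : ℕ) (x : ℝ) : ℝ :=
  ∑ k ∈ Finset.range (j / 2 + 1),
    (-1 : ℝ) ^ k * Real.Gamma (ν + (j : ℝ) - (k : ℝ)) /
      (Real.Gamma ν * Nat.factorial k * Nat.factorial (j - 2 * k)) * (2 * x) ^ (j - 2 * k)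

/-- The operator `L g (ζ) = - g'(ζ) / sin ζ`. -/
noncomputable def Lop (g : ℝ → ℝ) : ℝ → ℝ := fun ζ => -(deriv g ζ) / Real.sin ζ

open Polynomial in
theorem Polynomial.Chebyshev.abs_iterate_derivative_T_real_le_pow (n m : ℕ) {x : ℝ} (hx : |x| ≤ 1) :
    |(derivative^[n] (Chebyshev.T ℝ m)).eval x| ≤ (2 * n + 3 : ℝ) ^ m := by
  induction m using Nat.strong_induction_on generalizing n with
  | _ m ih =>
    match m with
    | 0 =>
      cases n with
      | zero => simp
      | succ n => simp [Polynomial.iterate_derivative_one]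
    | 1 =>
      match n with
      | 0 => simpa using hx.trans (by norm_num)
      | 1 => norm_num
      | n + 2 =>
        simp [Function.iterate_succ_apply]
        positivity
    | m + 2 =>
      have h0 := ih m (by omega)
      have h1 := ih (m + 1) (by omega)
      have hT : Chebyshev.T ℝ ((m + 2 : ℕ) : ℤ) =
          (2 : ℝ) • (Chebyshev.T ℝ ((m + 1 : ℕ) : ℤ) * X) - Chebyshev.T ℝ (m : ℤ) := by
        push_cast
        rw [Chebyshev.T_add_two, smul_eq_C_mul]
        simp only [map_ofNat]
        ring
      have hstep : |2 * ((derivative^[n] (Chebyshev.T ℝ ((m + 1 : ℕ) : ℤ))).eval x * x)| ≤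
          2 * (2 * n + 3 : ℝ) ^ (m + 1) := by
        rw [abs_mul, abs_mul, abs_two]
        have := mul_le_mul (h1 n) hx (abs_nonneg _) (by positivity)
        linarith
      have hpow : (2 * n + 3 : ℝ) ^ m ≤ (2 * n + 3 : ℝ) ^ (m + 1) :=
        pow_le_pow_right₀ (by linarith [(Nat.cast_nonneg n : (0 : ℝ) ≤ n)]) (by omega)
      have hd : |2 * (n * (derivative^[n - 1] (Chebyshev.T ℝ ((m + 1 : ℕ) : ℤ))).eval x)| ≤
          2 * (n * (2 * n + 3 : ℝ) ^ (m + 1)) := by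
        rw [abs_mul, abs_mul, abs_two, Nat.abs_cast]
        have : (2 * ((n - 1 : ℕ) : ℝ) + 3) ^ (m + 1) ≤ (2 * n + 3 : ℝ) ^ (m + 1) := by
          gcongr
          omega
        gcongr
        exact (h1 (n - 1)).trans this
      have key : (derivative^[n] (Chebyshev.T ℝ ((m + 2 : ℕ) : ℤ))).eval x =
          2 * ((derivative^[n] (Chebyshev.T ℝ ((m + 1 : ℕ) : ℤ))).eval x * x)
          + 2 * (n * (derivative^[n - 1] (Chebyshev.T ℝ ((m + 1 : ℕ) : ℤ))).eval x)
          - (derivative^[n] (Chebyshev.T ℝ (m : ℤ))).eval x := by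
        rw [hT, Polynomial.iterate_derivative_sub, Polynomial.iterate_derivative_smul,
          Polynomial.iterate_derivative_mul_X]
        simp
      rw [key]
      refine (abs_sub _ _).trans ((add_le_add (abs_add_le _ _) le_rfl).trans ?_)
      have hp : (2 * n + 3 : ℝ) ^ (m + 2) = (2 * n + 3 : ℝ) ^ (m + 1) * (2 * n + 3) := pow_succ _ _
      rw [hp]
      linarith [h0 n]

theorem gegenbauerC_one_eq_sum_choose (j N : ℕ) (hN : j / 2 < N) (x : ℝ) :
    gegenbauerC 1 j x =
      ∑ k ∈ Finset.range N, (-1 : ℝ) ^ k * (Nat.choose (j - k) k) * (2 * x) ^ (j - 2 * k) := by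
  rw [gegenbauerC]
  rw [← Finset.sum_subset (Finset.range_mono (show j / 2 + 1 ≤ N by omega))]
  · refine Finset.sum_congr rfl fun k hk => ?_
    have hk' : 2 * k ≤ j := by
      have := Finset.mem_range.1 hk
      omega
    have hG : Real.Gamma (1 + (j : ℝ) - (k : ℝ)) = Nat.factorial (j - k) := by
      rw [← Real.Gamma_nat_eq_factorial, Nat.cast_sub (by omega)]
      congr 1
      ring
    rw [hG, Real.Gamma_one, Nat.cast_choose ℝ (show k ≤ j - k by omega),
      show j - k - k = j - 2 * k by omega]
    ring
  · intro k _ hk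
    rw [Finset.mem_range, not_lt] at hk
    rw [Nat.choose_eq_zero_of_lt (by omega)]
    simp

theorem gegenbauerC_one_add_two (j : ℕ) (x : ℝ) :
    gegenbauerC 1 (j + 2) x = 2 * x * gegenbauerC 1 (j + 1) x - gegenbauerC 1 j x := by
  rw [gegenbauerC_one_eq_sum_choose (j + 2) (j + 3) (by omega),
    gegenbauerC_one_eq_sum_choose (j + 1) (j + 3) (by omega),
    gegenbauerC_one_eq_sum_choose j (j + 2) (by omega), Finset.sum_range_succ',
    Finset.sum_range_succ' _ (j + 2), mul_add, Finset.mul_sum, add_sub_right_comm,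
    ← Finset.sum_sub_distrib]
  congr 1
  · refine Finset.sum_congr rfl fun k _ => ?_
    rw [show j + 2 - 2 * (k + 1) = j - 2 * k by omega, show j + 1 - (k + 1) = j - k by omega]
    rcases le_or_gt k j with hk | hk
    · rw [show j + 2 - (k + 1) = j - k + 1 by omega, Nat.choose_succ_succ]
      rcases le_or_gt j (2 * k) with h | h
      · rw [Nat.choose_eq_zero_of_lt (show j - k < k.succ by omega)]
        push_cast
        ring
      · rw [show j - 2 * k = j + 1 - 2 * (k + 1) + 1 by omega]
        push_cast
        ring
    · rw [Nat.choose_eq_zero_of_lt (show j + 2 - (k + 1) < k + 1 by omega),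
        Nat.choose_eq_zero_of_lt (show j - k < k + 1 by omega),
        Nat.choose_eq_zero_of_lt (show j - k < k by omega)]
      simp
  · simp
    ring

open Polynomial in
theorem eval_chebyshevU_eq_gegenbauerC_one (j : ℕ) (x : ℝ) :
    (Chebyshev.U ℝ j).eval x = gegenbauerC 1 j x := by
  induction j using Nat.twoStepInduction with
  | zero => simp [gegenbauerC]
  | one => simp [gegenbauerC, one_add_one_eq_two]
  | more j h0 h1 =>
    rw [gegenbauerC_one_add_two, ← h0, ← h1]
    push_cast
    rw [Chebyshev.U_add_two]
    simp

theorem hasDerivAt_gegenbauerC_succ {ν : ℝ} (hν : 0 < ν) (j : ℕ) (x : ℝ) :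
    HasDerivAt (gegenbauerC ν (j + 1)) (2 * ν * gegenbauerC (ν + 1) j x) x := by
  have hterm : ∀ k ∈ Finset.range ((j + 1) / 2 + 1), HasDerivAt
      (fun x : ℝ => (-1 : ℝ) ^ k * Real.Gamma (ν + ((j + 1 : ℕ) : ℝ) - (k : ℝ)) /
        (Real.Gamma ν * Nat.factorial k * Nat.factorial (j + 1 - 2 * k)) *
          (2 * x) ^ (j + 1 - 2 * k))
      (if k ∈ Finset.range (j / 2 + 1) then
        2 * ν * ((-1 : ℝ) ^ k * Real.Gamma (ν + 1 + (j : ℝ) - (k : ℝ)) /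
        (Real.Gamma (ν + 1) * Nat.factorial k * Nat.factorial (j - 2 * k)) *
          (2 * x) ^ (j - 2 * k)) else 0) x := by
    intro k hk
    rw [Finset.mem_range] at hk
    split_ifs with hk'
    · rw [Finset.mem_range] at hk'
      have h := (((hasDerivAt_id x).const_mul (2 : ℝ)).pow (j + 1 - 2 * k)).const_mul
        ((-1 : ℝ) ^ k * Real.Gamma (ν + ((j + 1 : ℕ) : ℝ) - (k : ℝ)) /
        (Real.Gamma ν * Nat.factorial k * Nat.factorial (j + 1 - 2 * k)))
      refine h.congr_deriv ?_
      have hΓ : Real.Gamma ν ≠ 0 := (Real.Gamma_pos_of_pos hν).ne'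
      rw [Real.Gamma_add_one hν.ne', show j + 1 - 2 * k = j - 2 * k + 1 by omega,
        Nat.factorial_succ,
        show ν + ((j + 1 : ℕ) : ℝ) - (k : ℝ) = ν + 1 + (j : ℝ) - k by push_cast; ring]
      have h1 : ((j - 2 * k : ℕ) : ℝ) + 1 ≠ 0 := by positivity
      simp only [id, Nat.add_sub_cancel]
      push_cast
      field_simp
    · rw [Finset.mem_range] at hk'
      rw [show j + 1 - 2 * k = 0 by omega]
      simpa using hasDerivAt_const x _
  have h := HasDerivAt.fun_sum hterm
  rw [Finset.sum_ite_mem, Finset.inter_eq_right.2 (Finset.range_mono (by omega)),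
    ← Finset.mul_sum] at h
  exact h

open Polynomial in
theorem eval_iterate_derivative_chebyshevT (n m : ℕ) (x : ℝ) :
    (derivative^[n + 1] (Chebyshev.T ℝ ((m + (n + 1) : ℕ) : ℤ))).eval x =
      (m + (n + 1)) * (2 ^ n * Nat.factorial n) * gegenbauerC (n + 1) m x := by
  induction n generalizing m x with
  | zero =>
    rw [Function.iterate_one, Chebyshev.T_derivative_eq_U]
    simp [eval_chebyshevU_eq_gegenbauerC_one]
  | succ n ih =>
    rw [Function.iterate_succ_apply']
    refine (Polynomial.hasDerivAt _ x).unique ?_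
    have h := (hasDerivAt_gegenbauerC_succ (show (0 : ℝ) < n + 1 by positivity) m x).const_mul
      (((m + 1 : ℕ) + (n + 1)) * (2 ^ n * Nat.factorial n) : ℝ)
    refine (h.congr_deriv ?_).congr_of_eventuallyEq (Filter.Eventually.of_forall fun y => ?_)
    · rw [Nat.factorial_succ]
      push_cast
      ring
    · beta_reduce
      rw [← ih (m + 1) y, show m + (n + 1 + 1) = m + 1 + (n + 1) by ring]

open Polynomial in
theorem iterate_derivative_chebyshevT_eq_zero {n m : ℕ} (h : m < n) :
    derivative^[n] (Chebyshev.T ℝ (m : ℤ)) = 0 :=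
  Polynomial.iterate_derivative_eq_zero (by simpa using h)

theorem besselI_natCast (n : ℕ) (R : ℝ) :
    besselI n R =
      ∑' m : ℕ, (R / 2) ^ (2 * m + n) / (Nat.factorial m * Nat.factorial (m + n)) := by
  refine tsum_congr fun m => ?_
  rw [← Real.Gamma_nat_eq_factorial (m + n), ← Real.rpow_natCast]
  push_cast
  rfl

theorem besselI_term_le {R : ℝ} (hR : 0 ≤ R) (n m : ℕ) :
    (R / 2) ^ (2 * m + n) / (Nat.factorial m * Nat.factorial (m + n)) ≤
      (R / 2) ^ n / Nat.factorial n * (((R / 2) ^ 2) ^ m / Nat.factorial m) := by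
  rw [pow_add, pow_mul, mul_comm, mul_comm (Nat.factorial m : ℝ), mul_div_mul_comm]
  gcongr
  omega

theorem summable_besselI_term {R : ℝ} (hR : 0 ≤ R) (n : ℕ) :
    Summable fun m : ℕ => (R / 2) ^ (2 * m + n) / (Nat.factorial m * Nat.factorial (m + n)) :=
  Summable.of_nonneg_of_le (fun m => by positivity) (besselI_term_le hR n)
    ((Real.summable_pow_div_factorial _).mul_left _)

theorem hasSum_besselI {R : ℝ} (hR : 0 ≤ R) (n : ℕ) :
    HasSum (fun m : ℕ => (R / 2) ^ (2 * m + n) / (Nat.factorial m * Nat.factorial (m + n)))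
      (besselI n R) := by
  rw [besselI_natCast]
  exact (summable_besselI_term hR n).hasSum

theorem besselI_natCast_nonneg {R : ℝ} (hR : 0 ≤ R) (n : ℕ) : 0 ≤ besselI n R :=
  (hasSum_besselI hR n).nonneg fun m => by positivity

theorem besselI_natCast_le {R : ℝ} (hR : 0 ≤ R) (n : ℕ) :
    besselI n R ≤ (R / 2) ^ n / Nat.factorial n * Real.exp ((R / 2) ^ 2) := by
  refine hasSum_le (besselI_term_le hR n) (hasSum_besselI hR n) (HasSum.mul_left _ ?_)
  rw [Real.exp_eq_exp_ℝ]
  exact NormedSpace.expSeries_div_hasSum_exp _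

theorem summable_besselI_mul_pow {R : ℝ} (hR : 0 ≤ R) {p : ℕ} (hp : 1 ≤ p) {b : ℝ} (hb : 0 ≤ b) :
    Summable fun m : ℕ => besselI ((p * m : ℕ) : ℝ) R * b ^ m := by
  refine Summable.of_nonneg_of_le
    (fun m => mul_nonneg (besselI_natCast_nonneg hR _) (by positivity)) (fun m => ?_)
    ((Real.summable_pow_div_factorial ((R / 2) ^ p * b)).mul_left (Real.exp ((R / 2) ^ 2)))
  calc besselI ((p * m : ℕ) : ℝ) R * b ^ m
      ≤ (R / 2) ^ (p * m) / Nat.factorial (p * m) * Real.exp ((R / 2) ^ 2) * b ^ m := by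
        gcongr
        exact besselI_natCast_le hR _
    _ ≤ (R / 2) ^ (p * m) / Nat.factorial m * Real.exp ((R / 2) ^ 2) * b ^ m := by
        gcongr
        exact Nat.le_mul_of_pos_left m hp
    _ = _ := by
        rw [mul_pow, ← pow_mul]
        ring

/-- Pairs of naturals, parametrized by their difference and their minimum. -/
def intProdNatEquivNatProdNat : ℤ × ℕ ≃ ℕ × ℕ where
  toFun q := (q.2 + q.1.toNat, q.2 + (-q.1).toNat)
  invFun q := ((q.1 : ℤ) - q.2, min q.1 q.2)
  left_inv q := by
    ext <;> simp; omega
  right_inv q := by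
    ext <;> simp <;> omega

theorem hasSum_exp_mul_cos_prod (R θ : ℝ) :
    HasSum (fun q : ℕ × ℕ => (R / 2) ^ (q.1 + q.2) / (Nat.factorial q.1 * Nat.factorial q.2) *
      Real.cos (((q.1 : ℝ) - q.2) * θ)) (Real.exp (R * Real.cos θ)) := by
  have hexp : ∀ z : ℂ, HasSum (fun n : ℕ => z ^ n / Nat.factorial n) (Complex.exp z) := by
    intro z
    rw [Complex.exp_eq_exp_ℂ]
    exact NormedSpace.expSeries_div_hasSum_exp _
  obtain ⟨u, hu⟩ : ∃ u : ℂ, u = (R / 2 : ℝ) * Complex.exp (θ * Complex.I) := ⟨_, rfl⟩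
  obtain ⟨v, hv⟩ : ∃ v : ℂ, v = (R / 2 : ℝ) * Complex.exp (-(θ * Complex.I)) := ⟨_, rfl⟩
  have hs : Summable fun q : ℕ × ℕ =>
      (u ^ q.1 / Nat.factorial q.1) * (v ^ q.2 / Nat.factorial q.2) :=
    summable_mul_of_summable_norm (f := fun n : ℕ => u ^ n / Nat.factorial n)
      (g := fun n : ℕ => v ^ n / Nat.factorial n) (NormedSpace.norm_expSeries_div_summable u)
      (NormedSpace.norm_expSeries_div_summable v)
  have hterm : ∀ q : ℕ × ℕ, u ^ q.1 / Nat.factorial q.1 * (v ^ q.2 / Nat.factorial q.2) =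
      (((R / 2) ^ (q.1 + q.2) / (Nat.factorial q.1 * Nat.factorial q.2) : ℝ) : ℂ) *
        Complex.exp (((((q.1 : ℝ) - q.2) * θ : ℝ) : ℂ) * Complex.I) := by
    intro q
    rw [show ((((q.1 : ℝ) - q.2) * θ : ℝ) : ℂ) * Complex.I =
      q.1 * (θ * Complex.I) + q.2 * (-(θ * Complex.I)) by push_cast; ring,
      Complex.exp_add, Complex.exp_nat_mul, Complex.exp_nat_mul, hu, hv]
    push_cast
    ring
  have hsum : u + v = ((R * Real.cos θ : ℝ) : ℂ) := by
    have h2 := Complex.two_cos (θ : ℂ)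
    rw [neg_mul] at h2
    rw [hu, hv, ← mul_add, ← h2]
    push_cast
    ring
  have h := Complex.hasSum_re ((hexp u).mul (hexp v) hs)
  rw [← Complex.exp_add, hsum, Complex.exp_ofReal_re] at h
  refine h.congr_fun fun q => ?_
  rw [hterm, Complex.re_ofReal_mul, Complex.exp_ofReal_mul_I_re]

theorem hasSum_besselI_mul_cos {R : ℝ} (hR : 0 ≤ R) (θ : ℝ) :
    HasSum (fun k : ℤ => besselI (k.natAbs : ℝ) R * Real.cos (k * θ))
      (Real.exp (R * Real.cos θ)) := by
  refine (intProdNatEquivNatProdNat.hasSum_iff.2 (hasSum_exp_mul_cos_prod R θ)).prod_fiberwise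
    fun k => ?_
  convert! (hasSum_besselI hR k.natAbs).mul_right (Real.cos (k * θ)) using 1
  funext m
  simp only [Function.comp, intProdNatEquivNatProdNat, Equiv.coe_fn_mk]
  rw [show m + k.toNat + (m + (-k).toNat) = 2 * m + k.natAbs by omega]
  have hcast : (((m + k.toNat : ℕ) : ℝ) - ((m + (-k).toNat : ℕ) : ℝ)) = k := by
    have : ((m + k.toNat : ℕ) : ℤ) - ((m + (-k).toNat : ℕ) : ℤ) = k := by omega
    exact_mod_cast congrArg (Int.cast : ℤ → ℝ) this
  rw [hcast]
  congr 2
  rcases le_total 0 k with hk | hk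
  · rw [show (-k).toNat = 0 by omega, show k.toNat = k.natAbs by omega, add_zero, mul_comm]
  · rw [show k.toNat = 0 by omega, show (-k).toNat = k.natAbs by omega, add_zero]

theorem sum_cos_mul_of_not_dvd {p : ℕ} (hp : 1 ≤ p) {k : ℤ} (hk : ¬ (p : ℤ) ∣ k) (z : ℝ) :
    ∑ s ∈ Finset.Icc 1 p, Real.cos (k * ((z + (2 * (s : ℝ) + 1) * Real.pi) / p)) = 0 := by
  have hp0 : (p : ℂ) ≠ 0 := Nat.cast_ne_zero.2 (by omega)
  set w : ℂ := Complex.exp (2 * Real.pi * Complex.I * k / p) with hw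
  have hw1 : w ≠ 1 := by
    rw [hw, Ne, Complex.exp_eq_one_iff]
    rintro ⟨n, hn⟩
    apply hk
    refine ⟨n, ?_⟩
    have hpi : (2 * Real.pi * Complex.I : ℂ) ≠ 0 := Complex.two_pi_I_ne_zero
    have : (k : ℂ) = p * n := by
      field_simp at hn
      apply mul_left_cancel₀ hpi
      linear_combination (2 * Real.pi * Complex.I) * hn
    exact_mod_cast this
  have hwp : w ^ p = 1 := by
    rw [hw, ← Complex.exp_nat_mul, Complex.exp_eq_one_iff]
    exact ⟨k, by field_simp⟩
  have hgeom : ∑ s ∈ Finset.range p, w ^ s = 0 := by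
    have := mul_geom_sum w p
    rw [hwp, sub_self] at this
    exact (mul_eq_zero.1 this).resolve_left (sub_ne_zero.2 hw1)
  have hre : ∑ s ∈ Finset.Icc 1 p,
      Complex.exp (((k * ((z + (2 * (s : ℝ) + 1) * Real.pi) / p) : ℝ) : ℂ) * Complex.I) = 0 := by
    rw [← Finset.Ico_add_one_right_eq_Icc, Finset.sum_Ico_eq_sum_range, Nat.add_sub_cancel]
    have : ∀ s ∈ Finset.range p, Complex.exp
        (((k * ((z + (2 * ((1 + s : ℕ) : ℝ) + 1) * Real.pi) / p) : ℝ) : ℂ) * Complex.I) =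
        Complex.exp (k * ((z + 3 * Real.pi) / p) * Complex.I) * w ^ s := by
      intro s _
      rw [hw, ← Complex.exp_nat_mul, ← Complex.exp_add]
      congr 1
      push_cast
      ring
    rw [Finset.sum_congr rfl this, ← Finset.mul_sum, hgeom, mul_zero]
  have := congrArg Complex.re hre
  simpa only [Complex.re_sum, Complex.exp_ofReal_mul_I_re, Complex.zero_re] using this

theorem cos_mul_add_odd_mul_pi_div {p : ℕ} (hp : 1 ≤ p) (n : ℤ) (s : ℕ) (z : ℝ) :
    Real.cos (((p * n : ℤ) : ℝ) * ((z + (2 * (s : ℝ) + 1) * Real.pi) / p)) =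
      (-1) ^ n.natAbs * Real.cos (n * z) := by
  have hp0 : (p : ℝ) ≠ 0 := Nat.cast_ne_zero.2 (by omega)
  rw [show ((p * n : ℤ) : ℝ) * ((z + (2 * (s : ℝ) + 1) * Real.pi) / p) =
    n * z + n * Real.pi + ((n * s : ℤ) : ℝ) * (2 * Real.pi) by push_cast; field_simp; ring,
    Real.cos_add_int_mul_two_pi, Real.cos_add_int_mul_pi]
  congr 1
  rcases Int.natAbs_eq n with h | h
  · conv_lhs => rw [h]
    rw [zpow_natCast]
  · conv_lhs => rw [h]
    rw [zpow_neg, zpow_natCast, ← inv_pow]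
    norm_num

theorem hasSum_besselI_mean {R : ℝ} (hR : 0 ≤ R) {p : ℕ} (hp : 1 ≤ p) (z : ℝ) :
    HasSum (fun m : ℕ => 2 * (-1) ^ m * besselI ((p * m : ℕ) : ℝ) R * Real.cos (m * z))
      ((1 / (p : ℝ)) * ∑ s ∈ Finset.Icc 1 p,
          Real.exp (R * Real.cos ((z + (2 * (s : ℝ) + 1) * Real.pi) / (p : ℝ))) +
        besselI 0 R) := by
  have hp0 : (p : ℝ) ≠ 0 := Nat.cast_ne_zero.2 (by omega)
  have h1 := (hasSum_sum fun s (_ : s ∈ Finset.Icc 1 p) => hasSum_besselI_mul_cos hR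
    ((z + (2 * (s : ℝ) + 1) * Real.pi) / (p : ℝ))).mul_left (1 / (p : ℝ))
  simp_rw [← Finset.mul_sum] at h1
  have hinj : Function.Injective fun n : ℤ => (p : ℤ) * n :=
    mul_right_injective₀ (by omega)
  rw [← hinj.hasSum_iff] at h1
  · have h2 : HasSum (fun n : ℤ => (-1) ^ n.natAbs * besselI ((p * n.natAbs : ℕ) : ℝ) R *
        Real.cos (n * z)) ((1 / (p : ℝ)) * ∑ s ∈ Finset.Icc 1 p,
          Real.exp (R * Real.cos ((z + (2 * (s : ℝ) + 1) * Real.pi) / (p : ℝ)))) := by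
      convert! h1 using 1
      funext n
      simp only [Function.comp]
      rw [Finset.sum_congr rfl fun s _ => cos_mul_add_odd_mul_pi_div hp n s z, Finset.sum_const,
        Nat.card_Icc, Nat.add_sub_cancel, nsmul_eq_mul, Int.natAbs_mul, Int.natAbs_natCast]
      field_simp
    convert! h2.nat_add_neg using 1
    · funext m
      simp
      ring
    · simp
  · intro k hk
    rw [sum_cos_mul_of_not_dvd hp (fun ⟨n, hn⟩ => hk ⟨n, hn.symm⟩), mul_zero, mul_zero]

open Polynomial in
/-- Termwise `n`-th derivative of the Chebyshev series with coefficients `c`. -/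
noncomputable def chebyshevSeries (c : ℕ → ℝ) (n : ℕ) (x : ℝ) : ℝ :=
  ∑' m : ℕ, c m * (derivative^[n] (Chebyshev.T ℝ (m : ℤ))).eval x

theorem summable_chebyshevSeries {c : ℕ → ℝ} (n : ℕ)
    (hc : Summable fun m => |c m| * (2 * n + 3 : ℝ) ^ m) {x : ℝ} (hx : |x| ≤ 1) :
    Summable fun m : ℕ =>
      c m * (Polynomial.derivative^[n] (Polynomial.Chebyshev.T ℝ (m : ℤ))).eval x := by
  refine Summable.of_norm_bounded hc fun m => ?_
  rw [Real.norm_eq_abs, abs_mul]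
  exact mul_le_mul_of_nonneg_left
    (Polynomial.Chebyshev.abs_iterate_derivative_T_real_le_pow n m hx) (abs_nonneg _)

theorem hasDerivAt_chebyshevSeries {c : ℕ → ℝ}
    (hc : ∀ b : ℝ, 0 ≤ b → Summable fun m => |c m| * b ^ m) (n : ℕ) {x : ℝ}
    (hx : x ∈ Set.Ioo (-1 : ℝ) 1) :
    HasDerivAt (chebyshevSeries c n) (chebyshevSeries c (n + 1) x) x := by
  refine hasDerivAt_tsum_of_isPreconnected
    (g := fun (m : ℕ) x =>
      c m * (Polynomial.derivative^[n] (Polynomial.Chebyshev.T ℝ (m : ℤ))).eval x)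
    (g' := fun (m : ℕ) x =>
      c m * (Polynomial.derivative^[n + 1] (Polynomial.Chebyshev.T ℝ (m : ℤ))).eval x)
    (hc (2 * ((n + 1 : ℕ) : ℝ) + 3) (by positivity))
    isOpen_Ioo isPreconnected_Ioo (fun m y _ => ?_) (fun m y hy => ?_) hx
    (summable_chebyshevSeries n (hc _ (by positivity)) (abs_le.2 ⟨hx.1.le, hx.2.le⟩)) hx
  · rw [Function.iterate_succ_apply']
    exact (Polynomial.hasDerivAt _ y).const_mul _
  · rw [Real.norm_eq_abs, abs_mul]
    exact mul_le_mul_of_nonneg_left (Polynomial.Chebyshev.abs_iterate_derivative_T_real_le_pow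
      (n + 1) m (abs_le.2 ⟨hy.1.le, hy.2.le⟩)) (abs_nonneg _)

theorem Lop_eq_of_hasDerivAt {g F : ℝ → ℝ} {F' z : ℝ} (hz : z ∈ Set.Ioo 0 Real.pi)
    (hg : ∀ y ∈ Set.Ioo 0 Real.pi, g y = F (Real.cos y))
    (hF : HasDerivAt F F' (Real.cos z)) : Lop g z = F' := by
  have h : HasDerivAt g (F' * -Real.sin z) z :=
    (hF.comp z (Real.hasDerivAt_cos z)).congr_of_eventuallyEq
      (Filter.eventuallyEq_of_mem (isOpen_Ioo.mem_nhds hz) hg)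
  rw [Lop, h.deriv, mul_neg, neg_neg, mul_div_cancel_right₀]
  exact (Real.sin_pos_of_mem_Ioo hz).ne'

theorem cos_mem_Ioo {z : ℝ} (hz : z ∈ Set.Ioo 0 Real.pi) : Real.cos z ∈ Set.Ioo (-1 : ℝ) 1 := by
  have h0 := Real.sin_pos_of_mem_Ioo hz
  have h1 := Real.sin_sq_add_cos_sq z
  constructor <;> nlinarith

theorem iterate_Lop_eq_chebyshevSeries {c : ℕ → ℝ}
    (hc : ∀ b : ℝ, 0 ≤ b → Summable fun m => |c m| * b ^ m) {f : ℝ → ℝ} (a : ℝ)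
    (hf : ∀ z ∈ Set.Ioo 0 Real.pi, f z = chebyshevSeries c 0 (Real.cos z) - a) (n : ℕ) {z : ℝ}
    (hz : z ∈ Set.Ioo 0 Real.pi) :
    Lop^[n + 1] f z = chebyshevSeries c (n + 1) (Real.cos z) := by
  induction n generalizing z with
  | zero =>
    exact Lop_eq_of_hasDerivAt hz hf ((hasDerivAt_chebyshevSeries hc 0 (cos_mem_Ioo hz)).sub_const a)
  | succ n ih =>
    rw [Function.iterate_succ_apply']
    exact Lop_eq_of_hasDerivAt hz (fun y hy => ih hy)
      (hasDerivAt_chebyshevSeries hc (n + 1) (cos_mem_Ioo hz))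

theorem chebyshevSeries_succ_eq_tsum_gegenbauerC {c : ℕ → ℝ}
    (hc : ∀ b : ℝ, 0 ≤ b → Summable fun m => |c m| * b ^ m) (n : ℕ) {x : ℝ} (hx : |x| ≤ 1) :
    chebyshevSeries c (n + 1) x = ∑' j : ℕ, c (j + (n + 1)) *
      ((j + (n + 1)) * (2 ^ n * Nat.factorial n) * gegenbauerC (n + 1) j x) := by
  rw [chebyshevSeries,
    ← (summable_chebyshevSeries (n + 1) (hc _ (by positivity)) hx).sum_add_tsum_nat_add (n + 1),
    Finset.sum_eq_zero, zero_add]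
  · simp_rw [eval_iterate_derivative_chebyshevT]
  · intro m hm
    rw [iterate_derivative_chebyshevT_eq_zero (Finset.mem_range.1 hm)]
    simp

theorem stmt1 (p ν : ℕ) (hp : 1 ≤ p) (hν : 1 ≤ ν) (R : ℝ) (hR : 0 < R)
    (ζ : ℝ) (hζ : ζ ∈ Set.Ioo 0 Real.pi) :
    ∑' j : ℕ, ((j : ℝ) + (ν : ℝ)) * (-1 : ℝ) ^ j *
        besselI ((p : ℝ) * ((j : ℝ) + (ν : ℝ))) R * gegenbauerC (ν : ℝ) j (Real.cos ζ) =
      ((-1 : ℝ) ^ ν / (2 ^ ν * (Nat.factorial (ν - 1) : ℝ))) *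
        Lop^[ν] (fun z =>
          (1 / (p : ℝ)) * ∑ s ∈ Finset.Icc 1 p,
            Real.exp (R * Real.cos ((z + (2 * (s : ℝ) + 1) * Real.pi) / (p : ℝ)))) ζ := by
  obtain ⟨n, rfl⟩ : ∃ n, ν = n + 1 := ⟨ν - 1, by omega⟩
  set c : ℕ → ℝ := fun m => 2 * (-1) ^ m * besselI ((p * m : ℕ) : ℝ) R with hc_def
  have hc : ∀ b : ℝ, 0 ≤ b → Summable fun m => |c m| * b ^ m := by
    intro b hb
    refine ((summable_besselI_mul_pow hR.le hp hb).mul_left 2).congr fun m => ?_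
    rw [hc_def, abs_mul, abs_mul, abs_two, abs_pow, abs_neg, abs_one, one_pow, mul_one,
      abs_of_nonneg (besselI_natCast_nonneg hR.le _), mul_assoc]
  rw [iterate_Lop_eq_chebyshevSeries hc (besselI 0 R) (fun z _ => ?_) n hζ,
    chebyshevSeries_succ_eq_tsum_gegenbauerC hc n (Real.abs_cos_le_one ζ), ← tsum_mul_left]
  · refine tsum_congr fun j => ?_
    simp only [hc_def, Nat.add_sub_cancel]
    have hsq : ((-1 : ℝ) ^ (n + 1)) * (-1) ^ (n + 1) = 1 := by
      rw [← mul_pow]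
      norm_num
    have hfac : (Nat.factorial n : ℝ) ≠ 0 := by positivity
    push_cast
    rw [pow_add (-1 : ℝ) j (n + 1), pow_succ (2 : ℝ) n]
    generalize besselI _ R = B, gegenbauerC _ j _ = G, (-1 : ℝ) ^ j = d,
      (-1 : ℝ) ^ (n + 1) = e at hsq ⊢
    field_simp
    linear_combination (-(d * B * G)) * hsq
  · rw [eq_sub_iff_add_eq, ← (hasSum_besselI_mean hR.le hp z).tsum_eq]
    refine tsum_congr fun m => ?_
    simp [hc_def, Polynomial.Chebyshev.T_real_cos]
end

section
/- For every integer p ≥ 1, every R ≥ 0 and every real t, one has 2 Σ_{j=0}^∞ (−1)^j I_{pj}(R) cos(jt) = I_0(R) + (1/p) Σ_{s=1}^p exp( R cos((t+(2s+1)π)/p) ). -/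
/-- Modified Bessel function of the first kind of integer order `n ≥ 0`. -/
noncomputable def besselIN (n : ℕ) (R : ℝ) : ℝ :=
  ∑' m : ℕ, (R / 2) ^ (2 * m + n) / (Nat.factorial m * Nat.factorial (m + n))

theorem hasSum_besselIN (n : ℕ) (R : ℝ) :
    HasSum (fun m : ℕ => (R / 2) ^ (2 * m + n) / (Nat.factorial m * Nat.factorial (m + n)))
      (besselIN n R) := by
  refine Summable.hasSum ?_
  refine Summable.of_norm_bounded
    (((Real.summable_pow_div_factorial (|R / 2| ^ 2)).mul_left (|R / 2| ^ n))) fun m => ?_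
  have h : (1 : ℝ) ≤ Nat.factorial (m + n) := by
    exact_mod_cast Nat.succ_le_of_lt (Nat.factorial_pos _)
  have hm : (0 : ℝ) < Nat.factorial m := by exact_mod_cast Nat.factorial_pos m
  have h_num : ‖(R / 2) ^ (2 * m + n)‖ = |R / 2| ^ n * (|R / 2| ^ 2) ^ m := by
    rw [norm_pow, Real.norm_eq_abs, pow_add, pow_mul, mul_comm]
  have h_den : (0 : ℝ) < Nat.factorial m * Nat.factorial (m + n) := by positivity
  rw [norm_div, h_num, Real.norm_of_nonneg h_den.le, ← mul_div_assoc]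
  gcongr
  exact le_mul_of_one_le_right hm.le h

/-- Pairs of naturals, indexed by their difference and their minimum. -/
def intProdNatEquiv : ℤ × ℕ ≃ ℕ × ℕ where
  toFun q := (q.2 + q.1.toNat, q.2 + (-q.1).toNat)
  invFun q := ((q.1 : ℤ) - q.2, min q.1 q.2)
  left_inv q := by ext <;> simp <;> omega
  right_inv q := by ext <;> (simp; omega)

/-- Rearranging a double sum over pairs of naturals by the difference of the two indices. -/
theorem HasSum.int_prod_nat_fiberwise {f : ℕ × ℕ → ℂ} {a : ℂ} {g : ℤ → ℂ} (h : HasSum f a)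
    (hg : ∀ k, HasSum (fun m : ℕ => f (m + k.toNat, m + (-k).toNat)) (g k)) : HasSum g a :=
  HasSum.prod_fiberwise (intProdNatEquiv.hasSum_iff.mpr h) hg

theorem hasSum_exp_mul_exp (z w : ℂ) :
    HasSum (fun q : ℕ × ℕ => z ^ q.1 / (Nat.factorial q.1 : ℂ) *
      (w ^ q.2 / (Nat.factorial q.2 : ℂ))) (Complex.exp z * Complex.exp w) := by
  have hexp (z : ℂ) : HasSum (fun n : ℕ => z ^ n / (Nat.factorial n : ℂ)) (Complex.exp z) := by
    rw [Complex.exp_eq_exp_ℂ]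
    exact NormedSpace.expSeries_div_hasSum_exp z
  have hnorm (z : ℂ) : Summable fun n : ℕ => ‖z ^ n / (Nat.factorial n : ℂ)‖ := by
    simpa using Real.summable_pow_div_factorial ‖z‖
  have h : Summable fun q : ℕ × ℕ => z ^ q.1 / (Nat.factorial q.1 : ℂ) *
      (w ^ q.2 / (Nat.factorial q.2 : ℂ)) := by
    have h := summable_mul_of_summable_norm (hnorm z) (hnorm w)
    beta_reduce at h
    exact h
  have h' := (hexp z).mul (hexp w) h
  beta_reduce at h'
  exact h'

/-- Laurent expansion of the generating function of the modified Bessel functions. -/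
theorem hasSum_int_besselIN (R : ℝ) {u : ℂ} (hu : u ≠ 0) :
    HasSum (fun k : ℤ => (besselIN k.natAbs R : ℂ) * u ^ k)
      (Complex.exp (R / 2 * u) * Complex.exp (R / 2 * u⁻¹)) := by
  refine (hasSum_exp_mul_exp _ _).int_prod_nat_fiberwise fun k => ?_
  have hb := (Complex.hasSum_ofReal.mpr (hasSum_besselIN k.natAbs R)).mul_right (u ^ k)
  refine (congrArg (HasSum · _) (funext fun m => ?_)).mpr hb
  obtain ⟨n, rfl | rfl⟩ := k.eq_nat_or_neg
  · simp only [Int.toNat_natCast, Int.toNat_neg_natCast, Int.natAbs_natCast, zpow_natCast,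
      add_zero]
    push_cast
    simp only [mul_pow, inv_pow, pow_add]
    field_simp
    ring
  · simp only [Int.toNat_natCast, neg_neg, Int.toNat_neg_natCast, Int.natAbs_neg,
      Int.natAbs_natCast, zpow_neg, zpow_natCast, add_zero]
    push_cast
    simp only [mul_pow, inv_pow, pow_add]
    field_simp
    ring

theorem hasSum_two_mul_besselIN_mul_cos (R θ : ℝ) :
    HasSum (fun n : ℕ => 2 * besselIN n R * Real.cos (n * θ))
      (Real.exp (R * Real.cos θ) + besselIN 0 R) := by
  have h := (hasSum_int_besselIN R (Complex.exp_ne_zero (θ * Complex.I))).nat_add_neg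
  rw [← Complex.hasSum_ofReal]
  convert h using 1
  · ext n
    simp only [Int.natAbs_natCast, Int.natAbs_neg, ← Complex.exp_int_mul]
    push_cast
    rw [Complex.cos]
    ring_nf
  · rw [← Complex.exp_neg, ← Complex.exp_add]
    push_cast
    rw [Complex.cos]
    simp
    ring_nf

theorem sum_cos_eq_zero_of_not_dvd {p n : ℕ} (hp : p ≠ 0) (hn : ¬ p ∣ n) (t : ℝ) :
    ∑ s ∈ Finset.Icc 1 p, Real.cos (n * ((t + (2 * (s : ℝ) + 1) * Real.pi) / p)) = 0 := by
  have hζ := Complex.isPrimitiveRoot_exp p hp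
  set ζ := Complex.exp (2 * Real.pi * Complex.I / p) with hζdef
  have hne : ζ ^ n ≠ 1 := fun h => hn (hζ.dvd_of_pow_eq_one n h)
  have hsum : ∑ s ∈ Finset.range p, (ζ ^ n) ^ s = 0 := by
    have h := mul_geom_sum (ζ ^ n) p
    rw [← pow_mul, mul_comm n p, pow_mul, hζ.pow_eq_one, one_pow, sub_self] at h
    exact (mul_eq_zero.mp h).resolve_left (sub_ne_zero.mpr hne)
  have hterm (s : ℕ) : Real.cos (n * ((t + (2 * ((1 + s : ℕ) : ℝ) + 1) * Real.pi) / p)) =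
      (Complex.exp ((n * ((t + 3 * Real.pi) / p) : ℝ) * Complex.I) * (ζ ^ n) ^ s).re := by
    rw [hζdef, ← pow_mul, ← Complex.exp_nat_mul, ← Complex.exp_add,
      ← Complex.exp_ofReal_mul_I_re]
    congr 2
    push_cast
    ring
  rw [← Finset.Ico_add_one_right_eq_Icc, Finset.sum_Ico_eq_sum_range, Nat.add_sub_cancel]
  simp_rw [hterm]
  rw [← Complex.re_sum, ← Finset.mul_sum, hsum, mul_zero, Complex.zero_re]

theorem sum_cos_mul_eq {p : ℕ} (hp : p ≠ 0) (j : ℕ) (t : ℝ) :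
    ∑ s ∈ Finset.Icc 1 p,
        Real.cos ((p * j : ℕ) * ((t + (2 * (s : ℝ) + 1) * Real.pi) / p)) =
      p * ((-1) ^ j * Real.cos (j * t)) := by
  have hterm (s : ℕ) : Real.cos ((p * j : ℕ) * ((t + (2 * (s : ℝ) + 1) * Real.pi) / p)) =
      (-1) ^ j * Real.cos (j * t) := by
    have h : ((p * j : ℕ) : ℝ) * ((t + (2 * (s : ℝ) + 1) * Real.pi) / p) =
        j * t + (j * (2 * s + 1) : ℕ) * Real.pi := by
      push_cast
      field_simp
    rw [h, Real.cos_add_nat_mul_pi, mul_comm j, pow_mul, (odd_two_mul_add_one s).neg_one_pow]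
  rw [Finset.sum_congr rfl fun s _ => hterm s]
  simp

theorem stmt3 (p : ℕ) (hp : 1 ≤ p) (R : ℝ) (hR : 0 ≤ R) (t : ℝ) :
    2 * ∑' j : ℕ, (-1 : ℝ) ^ j * besselIN (p * j) R * Real.cos ((j : ℝ) * t) =
      besselIN 0 R + (1 / (p : ℝ)) * ∑ s ∈ Finset.Icc 1 p,
        Real.exp (R * Real.cos ((t + (2 * (s : ℝ) + 1) * Real.pi) / (p : ℝ))) := by
  have hp0 : p ≠ 0 := by omega
  have hpR : (p : ℝ) ≠ 0 := by exact_mod_cast hp0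
  have h := (hasSum_sum fun (s : ℕ) (_ : s ∈ Finset.Icc 1 p) =>
    hasSum_two_mul_besselIN_mul_cos R ((t + (2 * (s : ℝ) + 1) * Real.pi) / p)).mul_left
      (1 / (p : ℝ))
  simp_rw [← Finset.mul_sum] at h
  have hinj : Function.Injective fun j : ℕ => p * j := mul_right_injective₀ hp0
  rw [← hinj.hasSum_iff] at h
  · rw [← tsum_mul_left]
    convert h.tsum_eq using 1
    · refine tsum_congr fun j => ?_
      simp only [Function.comp_apply]
      rw [sum_cos_mul_eq hp0]
      field_simp
    · rw [Finset.sum_add_distrib, Finset.sum_const, Nat.card_Icc, Nat.add_sub_cancel,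
        nsmul_eq_mul, mul_add, one_div, inv_mul_cancel_left₀ hpR, add_comm]
  · intro n hn
    rw [sum_cos_eq_zero_of_not_dvd hp0 fun ⟨j, hj⟩ => hn ⟨j, hj.symm⟩]
    simp
end
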